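/- Let π : ℝ^d → ℝ be an everywhere strictly positive probability density with respect to Lebesgue measure whose second-order partial derivatives exist everywhere, let μ be the probability measure with density π, and let γ^d denote the standard Gaussian measure on ℝ^d. Let S : ℝ^d → ℝ^d be a continuously differentiable lower triangular monotone map that transports μ to γ^d. Then the following are equivalent: (a) there exist continuous functions g_1,…,g_d : ℝ^d → ℝ, with g_k depending only on the coordinates x_1,…,x_{k-1}, such that under μ the random variables U_k(x) := x_k − g_k(x), k = 1,…,d, are mutually independent and each U_k has a positive continuous density (i.e., μ is induced by an additive noise model compatible with the identity ordering); (b) for each k ∈ {1,…,d} there exists a strictly increasing differentiable map B_k : ℝ → ℝ such that ∂/∂x_k [B_k(S_k(x))] = 1 for all x ∈ ℝ^d. -/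

import Mathlib

open MeasureTheory ProbabilityTheory

/-- A map `S : ℝ^d → ℝ^d` is lower triangular if each component `S_k` depends only on the
coordinates `x_1, …, x_k`. -/
def LowerTriangular (d : ℕ) (S : (Fin d → ℝ) → Fin d → ℝ) : Prop :=
  ∀ k : Fin d, ∀ x y : Fin d → ℝ, (∀ i ≤ k, x i = y i) → S x k = S y k

/-- A map `S : ℝ^d → ℝ^d` is monotone (in the triangular sense) if for each `k` and each fixed
`x_1, …, x_{k-1}`, the map `t ↦ S_k(x_1,…,x_{k-1},t)` is strictly increasing. -/
def MonotoneLast (d : ℕ) (S : (Fin d → ℝ) → Fin d → ℝ) : Prop :=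
  ∀ (k : Fin d) (x : Fin d → ℝ), StrictMono fun t => S (Function.update x k t) k

/-- In dimension one, the cdf of a law with positive continuous density is differentiable. -/
lemma cdf_hasStrictDerivAt (ν : Measure ℝ) [IsProbabilityMeasure ν] (p : ℝ → ℝ)
    (hc : Continuous p) (hp : ∀ t, 0 < p t)
    (hν : ν = volume.withDensity fun t => ENNReal.ofReal (p t)) (x : ℝ) :
    HasStrictDerivAt (cdf ν) (p x) x := by
  have hfin : ∫⁻ t, ENNReal.ofReal (p t) < ⊤ := by
    have h1 : ν Set.univ = ∫⁻ t, ENNReal.ofReal (p t) := by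
      rw [hν, withDensity_apply _ MeasurableSet.univ, Measure.restrict_univ]
    rw [← h1]; exact measure_lt_top _ _
  have hint : Integrable p := by
    refine ⟨hc.aestronglyMeasurable, ?_⟩
    rw [hasFiniteIntegral_iff_ofReal (Filter.Eventually.of_forall fun t => (hp t).le)]
    exact hfin
  have hcdf : ∀ y, cdf ν y = ∫ t in Set.Iic y, p t := by
    intro y
    rw [cdf_eq_real, measureReal_def, hν, withDensity_apply _ measurableSet_Iic,
      ← integral_eq_lintegral_of_nonneg_ae (Filter.Eventually.of_forall fun t => (hp t).le)
        hc.aestronglyMeasurable.restrict]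
  have hd : ∀ y, HasDerivAt (cdf ν) (p y) y := by
    intro y
    have h2 : (cdf ν : ℝ → ℝ) = fun y => cdf ν 0 + ∫ t in (0:ℝ)..y, p t := by
      funext y
      rw [hcdf, hcdf, ← intervalIntegral.integral_Iic_sub_Iic hint.integrableOn hint.integrableOn]
      ring
    rw [h2]
    exact (intervalIntegral.integral_hasDerivAt_right (hc.intervalIntegrable _ _)
      (hc.stronglyMeasurableAtFilter _ _) hc.continuousAt).const_add _
  exact hasStrictDerivAt_of_hasDerivAt_of_continuousAt (Filter.Eventually.of_forall hd)
    hc.continuousAt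

lemma cdf_strictMono' (ν : Measure ℝ) [IsProbabilityMeasure ν] (p : ℝ → ℝ)
    (hc : Continuous p) (hp : ∀ t, 0 < p t)
    (hν : ν = volume.withDensity fun t => ENNReal.ofReal (p t)) : StrictMono (cdf ν) := by
  apply strictMono_of_deriv_pos
  intro x
  rw [(cdf_hasStrictDerivAt ν p hc hp hν x).hasDerivAt.deriv]
  exact hp x

lemma cdf_exists (ν : Measure ℝ) [IsProbabilityMeasure ν] (p : ℝ → ℝ)
    (hc : Continuous p) (hp : ∀ t, 0 < p t)
    (hν : ν = volume.withDensity fun t => ENNReal.ofReal (p t)) (y : ℝ) (h0 : 0 < y)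
    (h1 : y < 1) : ∃ x, cdf ν x = y := by
  have hcont : Continuous (cdf ν) := continuous_iff_continuousAt.2 fun x =>
    (cdf_hasStrictDerivAt ν p hc hp hν x).hasDerivAt.continuousAt
  obtain ⟨a, ha⟩ := ((tendsto_cdf_atBot ν).eventually (gt_mem_nhds h0)).exists
  obtain ⟨b, hb⟩ := ((tendsto_cdf_atTop ν).eventually (lt_mem_nhds h1)).exists
  exact mem_range_of_exists_le_of_exists_ge hcont ⟨a, ha.le⟩ ⟨b, hb.le⟩

lemma cdf_mem (ν : Measure ℝ) [IsProbabilityMeasure ν] (p : ℝ → ℝ)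
    (hc : Continuous p) (hp : ∀ t, 0 < p t)
    (hν : ν = volume.withDensity fun t => ENNReal.ofReal (p t)) (x : ℝ) :
    0 < cdf ν x ∧ cdf ν x < 1 := by
  have hm := cdf_strictMono' ν p hc hp hν
  exact ⟨(cdf_nonneg ν (x - 1)).trans_lt (hm (by linarith)),
    (hm (show x < x + 1 by linarith)).trans_le (cdf_le_one ν _)⟩

/-- The increasing rearrangement between two laws with positive continuous densities. -/
lemma exists_rearrangement (ν₁ ν₂ : Measure ℝ) [IsProbabilityMeasure ν₁] [IsProbabilityMeasure ν₂]
    (p q : ℝ → ℝ) (hpc : Continuous p) (hp : ∀ t, 0 < p t)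
    (hν₁ : ν₁ = volume.withDensity fun t => ENNReal.ofReal (p t))
    (hqc : Continuous q) (hq : ∀ t, 0 < q t)
    (hν₂ : ν₂ = volume.withDensity fun t => ENNReal.ofReal (q t)) :
    ∃ B : ℝ → ℝ, StrictMono B ∧ Differentiable ℝ B ∧ ∀ t, cdf ν₁ (B t) = cdf ν₂ t := by
  have hex : ∀ t, ∃ u, cdf ν₁ u = cdf ν₂ t := fun t =>
    cdf_exists ν₁ p hpc hp hν₁ _ (cdf_mem ν₂ q hqc hq hν₂ t).1 (cdf_mem ν₂ q hqc hq hν₂ t).2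
  choose B hB using hex
  have hm₁ := cdf_strictMono' ν₁ p hpc hp hν₁
  have hm₂ := cdf_strictMono' ν₂ q hqc hq hν₂
  have hBm : StrictMono B := by
    intro s t hst
    rw [← hm₁.lt_iff_lt, hB, hB]
    exact hm₂ hst
  have hBs : Function.Surjective B := by
    intro u
    obtain ⟨t, ht⟩ := cdf_exists ν₂ q hqc hq hν₂ _ (cdf_mem ν₁ p hpc hp hν₁ u).1
      (cdf_mem ν₁ p hpc hp hν₁ u).2
    exact ⟨t, hm₁.injective (by rw [hB, ht])⟩
  have hBc : Continuous B := hBm.monotone.continuous_of_surjective hBs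
  refine ⟨B, hBm, fun t => ?_, hB⟩
  have hd := cdf_hasStrictDerivAt ν₁ p hpc hp hν₁ (B t)
  have hne : p (B t) ≠ 0 := (hp _).ne'
  have hG := (hd.to_localInverse hne).hasDerivAt
  rw [hB t] at hG
  have hcomp := hG.comp t (cdf_hasStrictDerivAt ν₂ q hqc hq hν₂ t).hasDerivAt
  have hev : ∀ᶠ s in nhds t, B s = (hd.localInverse (cdf ν₁) (p (B t)) (B t) hne ∘ cdf ν₂) s := by
    have := hBc.continuousAt.eventually (hd.eventually_left_inverse hne)
    filter_upwards [this] with s hs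
    rw [Function.comp_apply, ← hB s, hs]
  exact (hcomp.congr_of_eventuallyEq hev).differentiableAt

/-- A set depending only on `x_1,…,x_{k-1}` is independent of the `k`-th component of a triangular
map with independent components. -/
lemma indep_of_triangular (d : ℕ) (μ : Measure (Fin d → ℝ)) [IsProbabilityMeasure μ]
    (T : (Fin d → ℝ) → Fin d → ℝ) (hT : Continuous T) (htri : LowerTriangular d T)
    (hmon : MonotoneLast d T) (hind : iIndepFun (fun k x => T x k) μ) (k : Fin d)
    (A : Set (Fin d → ℝ)) (hA : IsOpen A)
    (hAdep : ∀ x y : Fin d → ℝ, (∀ i < k, x i = y i) → x ∈ A → y ∈ A)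
    (C : Set ℝ) (hC : MeasurableSet C) :
    μ (A ∩ {x | T x k ∈ C}) = μ A * μ {x | T x k ∈ C} := by
  classical
  let ext : (Finset.Iio k → ℝ) → (Fin d → ℝ) := fun y j =>
    if h : j ∈ Finset.Iio k then y ⟨j, h⟩ else 0
  have hext : Continuous ext := by
    refine continuous_pi fun j => ?_
    by_cases h : j ∈ Finset.Iio k
    · simp only [ext, dif_pos h]; fun_prop
    · simp only [ext, dif_neg h]; fun_prop
  have hext_res : ∀ x : Fin d → ℝ, ∀ i < k, ext (fun j => x j) i = x i := by
    intro x i hi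
    simp [ext, hi]
  let V : (Finset.Iio k → ℝ) → (Finset.Iio k → ℝ) := fun y i => T (ext y) i
  have hV : Continuous V := by
    refine continuous_pi fun i => ?_
    exact (continuous_apply _).comp (hT.comp hext)
  have hinj : Function.Injective V := by
    intro y z hyz
    have key : ∀ n : ℕ, ∀ i : Fin d, i.val = n → (hi : i ∈ Finset.Iio k) →
        y ⟨i, hi⟩ = z ⟨i, hi⟩ := by
      intro n
      induction n using Nat.strong_induction_on with
      | _ n ih =>
        intro i hin hi
        have h1 : T (ext y) i = T (ext z) i := congrFun hyz ⟨i, hi⟩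
        have h2 : T (ext z) i = T (Function.update (ext y) i (ext z i)) i := by
          apply htri
          intro j hj
          rcases eq_or_lt_of_le hj with rfl | hj
          · simp
          · have hjk : j ∈ Finset.Iio k := Finset.mem_Iio.2 (hj.trans (Finset.mem_Iio.1 hi))
            rw [Function.update_of_ne hj.ne]
            simp only [ext, dif_pos hjk]
            exact (ih j.val (by rw [← hin]; exact hj) j rfl hjk).symm
        have h3 : T (ext y) i = T (Function.update (ext y) i (ext y i)) i := by
          rw [Function.update_eq_self]
        have h4 := (hmon i (ext y)).injective (h3.symm.trans (h1.trans h2))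
        simpa only [ext, dif_pos hi] using h4
    funext i
    exact key _ i.1 rfl i.2
  have hA'm : MeasurableSet (V '' (ext ⁻¹' A)) :=
    (hA.preimage hext).measurableSet.image_of_continuousOn_injOn hV.continuousOn hinj.injOn
  have hAeq : A = (fun x (i : Finset.Iio k) => T x i) ⁻¹' (V '' (ext ⁻¹' A)) := by
    have hVr : ∀ x : Fin d → ℝ, V (fun j => x j) = fun i : Finset.Iio k => T x i := by
      intro x
      funext i
      apply htri
      intro j hj
      exact hext_res x j (hj.trans_lt (Finset.mem_Iio.1 i.2))
    ext x
    constructor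
    · intro hx
      refine ⟨fun j => x j, ?_, hVr x⟩
      exact hAdep x _ (fun i hi => (hext_res x i hi).symm) hx
    · rintro ⟨y, hy, hyx⟩
      rw [Set.mem_preimage] at hy
      have : y = fun j : Finset.Iio k => x j := hinj (Eq.trans hyx (hVr x).symm)
      rw [this] at hy
      exact hAdep _ x (hext_res x) hy
  have hTm : ∀ i, Measurable fun x => T x i := fun i =>
    ((continuous_apply i).comp hT).measurable
  have hψ : Measurable fun z : ({k} : Finset (Fin d)) → ℝ => z ⟨k, by simp⟩ :=
    measurable_pi_apply _
  have hI := (hind.indepFun_finset (Finset.Iio k) {k} (by simp) hTm).comp measurable_id hψ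
  have := hI.measure_inter_preimage_eq_mul _ _ hA'm hC
  conv_lhs => rw [hAeq]
  conv_rhs => rw [hAeq]
  exact this

/-- One-sided comparison of monotone components. -/
lemma no_crossing (d : ℕ) (μ : Measure (Fin d → ℝ)) [IsProbabilityMeasure μ]
    [μ.IsOpenPosMeasure] (S T : (Fin d → ℝ) → Fin d → ℝ)
    (hS : Continuous S) (hStri : LowerTriangular d S)
    (hSmon : MonotoneLast d S) (hSind : iIndepFun (fun k x => S x k) μ)
    (hT : Continuous T) (hTtri : LowerTriangular d T)
    (hTmon : MonotoneLast d T) (hTind : iIndepFun (fun k x => T x k) μ) (k : Fin d)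
    (a b : ℝ) (hab : μ {x | S x k ∈ Set.Iic a} = μ {x | T x k ∈ Set.Iic b})
    (x : Fin d → ℝ) (hx1 : S x k < a) (hx2 : b < T x k) : False := by
  have hSk : Continuous fun x => S x k := (continuous_apply k).comp hS
  have hTk : Continuous fun x => T x k := (continuous_apply k).comp hT
  let A : Set (Fin d → ℝ) :=
    ⋃ s : ℝ, {x | S (Function.update x k s) k < a ∧ b < T (Function.update x k s) k}
  have hup : ∀ s : ℝ, Continuous fun x : Fin d → ℝ => Function.update x k s := fun s =>
    continuous_id.update k continuous_const
  have hAo : IsOpen A := isOpen_iUnion fun s =>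
    (isOpen_lt (hSk.comp (hup s)) continuous_const).inter
      (isOpen_lt continuous_const (hTk.comp (hup s)))
  have hAdep : ∀ x y : Fin d → ℝ, (∀ i < k, x i = y i) → x ∈ A → y ∈ A := by
    intro x y hxy hx
    obtain ⟨s, h1, h2⟩ := Set.mem_iUnion.1 hx
    have hag : ∀ i ≤ k, Function.update x k s i = Function.update y k s i := by
      intro i hi
      rcases eq_or_lt_of_le hi with rfl | hi
      · simp
      · rw [Function.update_of_ne hi.ne, Function.update_of_ne hi.ne, hxy i hi]
    refine Set.mem_iUnion.2 ⟨s, ?_, ?_⟩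
    · rw [← hStri k _ _ hag]; exact h1
    · rw [← hTtri k _ _ hag]; exact h2
  have hI1 := indep_of_triangular d μ S hS hStri hSmon hSind k A hAo hAdep (Set.Iic a)
    measurableSet_Iic
  have hI2 := indep_of_triangular d μ T hT hTtri hTmon hTind k A hAo hAdep (Set.Iic b)
    measurableSet_Iic
  have heq : μ (A ∩ {x | T x k ∈ Set.Iic b}) = μ (A ∩ {x | S x k ∈ Set.Iic a}) := by
    rw [hI1, hI2, hab]
  have hsub : A ∩ {x | T x k ∈ Set.Iic b} ⊆ A ∩ {x | S x k ∈ Set.Iic a} := by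
    rintro z ⟨hz, hzT⟩
    refine ⟨hz, ?_⟩
    obtain ⟨s, h1, h2⟩ := Set.mem_iUnion.1 hz
    have h3 : T (Function.update z k (z k)) k < T (Function.update z k s) k := by
      rw [Function.update_eq_self]; exact lt_of_le_of_lt hzT h2
    have h4 : z k < s := (hTmon k z).lt_iff_lt.1 h3
    have h5 := hSmon k z h4
    simp only [Function.update_eq_self] at h5
    exact (h5.trans h1).le
  have hmeas : MeasurableSet (A ∩ {x | T x k ∈ Set.Iic b}) :=
    hAo.measurableSet.inter (hTk.measurable measurableSet_Iic)
  have hdiff : μ ((A ∩ {x | S x k ∈ Set.Iic a}) \ (A ∩ {x | T x k ∈ Set.Iic b})) = 0 := by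
    rw [measure_sdiff hsub hmeas.nullMeasurableSet (measure_ne_top _ _), heq, tsub_self]
  have hG : IsOpen {x | S x k < a ∧ b < T x k} :=
    (isOpen_lt hSk continuous_const).inter (isOpen_lt continuous_const hTk)
  have hGz : μ {x | S x k < a ∧ b < T x k} = 0 := by
    refine measure_mono_null ?_ hdiff
    rintro z ⟨h1, h2⟩
    refine ⟨⟨Set.mem_iUnion.2 ⟨z k, ?_⟩, h1.le⟩, fun h => ?_⟩
    · simp only [Set.mem_ofPred_eq, Function.update_eq_self]
      exact ⟨h1, h2⟩
    · exact absurd h.2 (not_le.2 h2)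
  exact (hG.measure_pos μ ⟨x, hx1, hx2⟩).ne' hGz

lemma gaussian_density : gaussianReal 0 1 =
    volume.withDensity fun t => ENNReal.ofReal (gaussianPDFReal 0 1 t) := by
  rw [gaussianReal_of_var_ne_zero _ one_ne_zero]; rfl

lemma gaussian_cont : Continuous (gaussianPDFReal 0 1) := by
  unfold gaussianPDFReal; fun_prop

/-- Law of the image of the Gaussian under an increasing map with a `C¹` inverse. -/
lemma map_gaussian (B T : ℝ → ℝ) (hB : StrictMono B) (hBd : Differentiable ℝ B)
    (hT : ContDiff ℝ 1 T) (hTm : StrictMono T) (hBT : ∀ u, B (T u) = u) :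
    ∃ p : ℝ → ℝ, Continuous p ∧ (∀ t, 0 < p t) ∧
      (gaussianReal 0 1).map B = volume.withDensity fun t => ENNReal.ofReal (p t) := by
  have hTd : Differentiable ℝ T := hT.differentiable one_ne_zero
  have hpos : ∀ u, 0 < deriv T u := by
    intro u
    have h0 : 0 ≤ deriv T u := hTm.monotone.deriv_nonneg
    refine lt_of_le_of_ne h0 fun h => ?_
    have h1 := (hBd (T u)).hasDerivAt.comp u (hTd u).hasDerivAt
    have h2 : B ∘ T = id := funext hBT
    rw [h2, ← h, mul_zero] at h1
    exact zero_ne_one (h1.unique (hasDerivAt_id u))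
  refine ⟨fun u => deriv T u * gaussianPDFReal 0 1 (T u),
    (hT.continuous_deriv le_rfl).mul (gaussian_cont.comp hT.continuous),
    fun u => mul_pos (hpos u) (gaussianPDFReal_pos _ _ _ one_ne_zero), ?_⟩
  ext s hs
  have himg : B ⁻¹' s = T '' s := by
    ext z
    constructor
    · intro hz
      exact ⟨B z, hz, hB.injective (hBT _)⟩
    · rintro ⟨u, hu, rfl⟩
      simpa [hBT] using hu
  rw [Measure.map_apply hBd.continuous.measurable hs, himg, gaussian_density,
    withDensity_apply' , withDensity_apply _ hs,
    lintegral_image_eq_lintegral_abs_deriv_mul hs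
      (fun u _ => (hTd u).hasDerivAt.hasDerivWithinAt) hTm.injective.injOn]
  refine lintegral_congr fun u => ?_
  rw [abs_of_pos (hpos u), ENNReal.ofReal_mul (hpos u).le]

/-- Characterization of additive noise models (identity ordering) via the Knothe–Rosenblatt map:
for a probability measure `μ` with smooth positive density `π` and a `C¹` lower triangular
monotone map `S` transporting `μ` to the standard Gaussian `γ^d`, `μ` is induced by an additive
noise model `X_k = g_k(X_1,…,X_{k-1}) + U_k` (with mutually independent noises having positive
continuous densities) if and only if for each `k` there is a strictly increasing differentiable
`B_k : ℝ → ℝ` with `∂/∂x_k [B_k(S_k(x))] = 1` everywhere. -/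
theorem stmt8 (d : ℕ) (hd : 1 ≤ d)
    (π : (Fin d → ℝ) → ℝ) (hpos : ∀ x, 0 < π x) (hsmooth : ContDiff ℝ 2 π)
    (μ : Measure (Fin d → ℝ))
    (hμ : μ = volume.withDensity fun x => ENNReal.ofReal (π x))
    [IsProbabilityMeasure μ]
    (S : (Fin d → ℝ) → Fin d → ℝ)
    (hSreg : ContDiff ℝ 1 S)
    (htri : LowerTriangular d S) (hmon : MonotoneLast d S)
    (hpush : μ.map S = Measure.pi fun _ : Fin d => gaussianReal 0 1) :
    (∃ g : Fin d → (Fin d → ℝ) → ℝ,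
      (∀ k, Continuous (g k)) ∧
      (∀ (k : Fin d) (x y : Fin d → ℝ), (∀ i < k, x i = y i) → g k x = g k y) ∧
      iIndepFun (fun (k : Fin d) x => x k - g k x) μ ∧
      ∀ k : Fin d, ∃ p : ℝ → ℝ, Continuous p ∧ (∀ t, 0 < p t) ∧
        μ.map (fun x => x k - g k x) = volume.withDensity fun t => ENNReal.ofReal (p t)) ↔
    (∀ k : Fin d, ∃ B : ℝ → ℝ, StrictMono B ∧ Differentiable ℝ B ∧
      ∀ x : Fin d → ℝ,
        HasDerivAt (fun t => B (S (Function.update x k t) k)) 1 (x k)) := by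
  have hS : Continuous S := hSreg.continuous
  have hSm : ∀ k, Measurable fun x => S x k := fun k =>
    ((continuous_apply k).comp hS).measurable
  have hopen : μ.IsOpenPosMeasure := by
    have hac : (volume : Measure (Fin d → ℝ)) ≪ μ := by
      rw [hμ]
      refine withDensity_absolutelyContinuous' ?_ ?_
      · exact hsmooth.continuous.measurable.ennreal_ofReal.aemeasurable
      · exact Filter.Eventually.of_forall fun x => (ENNReal.ofReal_pos.2 (hpos x)).ne'
    exact hac.isOpenPosMeasure
  have hlaw : ∀ k, μ.map (fun x => S x k) = gaussianReal 0 1 := by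
    intro k
    have h := (measurePreserving_eval (fun _ : Fin d => gaussianReal 0 1) k).map_eq
    rw [← hpush, Measure.map_map (measurable_pi_apply k) hS.measurable] at h
    exact h
  have hSind : iIndepFun (fun k x => S x k) μ := by
    rw [iIndepFun_iff_map_fun_eq_pi_map fun k => (hSm k).aemeasurable]
    simp only [hlaw]
    exact hpush
  constructor
  · rintro ⟨g, hgc, hgdep, hgind, hgp⟩ k
    obtain ⟨p, hpc, hp, hplaw⟩ := hgp k
    let U : (Fin d → ℝ) → Fin d → ℝ := fun x j => x j - g j x
    have hU : Continuous U := continuous_pi fun j => (continuous_apply j).sub (hgc j)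
    have hgup : ∀ (j : Fin d) (x : Fin d → ℝ) (s : ℝ), g j (Function.update x j s) = g j x := by
      intro j x s
      exact hgdep j _ _ fun i hi => Function.update_of_ne hi.ne _ _
    have hUtri : LowerTriangular d U := by
      intro j x y hxy
      simp only [U]
      rw [hxy j le_rfl, hgdep j x y fun i hi => hxy i hi.le]
    have hUmon : MonotoneLast d U := by
      intro j x s t hst
      simp only [U, hgup, Function.update_self]
      linarith
    have hUm : Measurable fun x => x k - g k x := ((continuous_apply k).comp hU).measurable
    have hprob : IsProbabilityMeasure (μ.map (fun x => x k - g k x)) :=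
      Measure.isProbabilityMeasure_map hUm.aemeasurable
    obtain ⟨B, hBm, hBd, hB⟩ := exists_rearrangement (μ.map (fun x => x k - g k x))
      (gaussianReal 0 1) p (gaussianPDFReal 0 1) hpc hp hplaw gaussian_cont
      (fun t => gaussianPDFReal_pos _ _ _ one_ne_zero) gaussian_density
    have hmeas : ∀ t, μ {x | U x k ∈ Set.Iic (B t)} = μ {x | S x k ∈ Set.Iic t} := by
      intro t
      have h1 := hB t
      have h2 : (μ.map (fun x => x k - g k x)) (Set.Iic (B t)) = gaussianReal 0 1 (Set.Iic t) := by
        rw [← ofReal_cdf, ← ofReal_cdf, h1]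
      rw [← hlaw k, Measure.map_apply hUm measurableSet_Iic,
        Measure.map_apply (hSm k) measurableSet_Iic] at h2
      exact h2
    have hkey : ∀ x, B (S x k) = x k - g k x := by
      intro x
      rcases lt_trichotomy (B (S x k)) (U x k) with h | h | h
      · exfalso
        obtain ⟨t, ht1, ht2⟩ := ((hBd.continuous.continuousAt.eventually
          (gt_mem_nhds h)).filter_mono nhdsWithin_le_nhds |>.and
            (self_mem_nhdsWithin : Set.Ioi (S x k) ∈ nhdsWithin (S x k) (Set.Ioi (S x k)))).exists
        exact no_crossing d μ S U hS htri hmon hSind hU hUtri hUmon hgind k t (B t)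
          (hmeas t).symm x ht2 ht1
      · exact h
      · exfalso
        obtain ⟨t, ht1, ht2⟩ := ((hBd.continuous.continuousAt.eventually
          (lt_mem_nhds h)).filter_mono nhdsWithin_le_nhds |>.and
            (self_mem_nhdsWithin : Set.Iio (S x k) ∈ nhdsWithin (S x k) (Set.Iio (S x k)))).exists
        exact no_crossing d μ U S hU hUtri hUmon hgind hS htri hmon hSind k (B t) t
          (hmeas t) x ht1 ht2
    refine ⟨B, hBm, hBd, fun x => ?_⟩
    simp only [hkey, hgup, Function.update_self]
    exact (hasDerivAt_id (x k)).sub_const _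
  · intro h
    choose B hBm hBd hBder using h
    have hline : ∀ (k : Fin d) (x : Fin d → ℝ) (s t : ℝ),
        B k (S (Function.update x k s) k) - s = B k (S (Function.update x k t) k) - t := by
      intro k x s t
      have hder : ∀ s, HasDerivAt (fun t => B k (S (Function.update x k t) k) - t) 0 s := by
        intro s
        have h1 := hBder k (Function.update x k s)
        simp only [Function.update_idem, Function.update_self] at h1
        have h2 := h1.sub (hasDerivAt_id s)
        rw [sub_self] at h2
        exact h2
      exact is_const_of_deriv_eq_zero (fun s => (hder s).differentiableAt)
        (fun s => (hder s).deriv) s t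
    have hUeq : ∀ k : Fin d, (fun x : Fin d → ℝ => x k - (x k - B k (S x k)))
        = fun x => B k (S x k) := by
      intro k; funext x; ring
    refine ⟨fun k x => x k - B k (S x k), ?_, ?_, ?_, ?_⟩
    · intro k
      exact (continuous_apply k).sub ((hBd k).continuous.comp ((continuous_apply k).comp hS))
    · intro k x y hxy
      have h1 : S x k = S (Function.update y k (x k)) k := by
        apply htri
        intro i hi
        rcases eq_or_lt_of_le hi with rfl | hi
        · simp
        · rw [Function.update_of_ne hi.ne, hxy i hi]
      have h2 := hline k y (x k) (y k)
      rw [← h1, Function.update_eq_self] at h2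
      linarith
    · have hfam : (fun (k : Fin d) (x : Fin d → ℝ) => x k - (x k - B k (S x k)))
          = fun k x => B k (S x k) := funext hUeq
      rw [hfam]
      exact hSind.comp B fun k => (hBd k).continuous.measurable
    · intro k
      simp only [hUeq]
      have hmap : μ.map (fun x => B k (S x k)) = (gaussianReal 0 1).map (B k) := by
        rw [← hlaw k, Measure.map_map (hBd k).continuous.measurable (hSm k)]
        rfl
      rw [hmap]
      let b : ℝ := B k (S (Function.update (0 : Fin d → ℝ) k 0) k)
      refine map_gaussian (B k) (fun u => S (Function.update (0 : Fin d → ℝ) k (u - b)) k)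
        (hBm k) (hBd k) ?_ ?_ ?_
      · have h1 : ContDiff ℝ 1 fun u : ℝ => Function.update (0 : Fin d → ℝ) k (u - b) :=
          (contDiff_update 1 (0 : Fin d → ℝ) k).comp (contDiff_id.sub contDiff_const)
        exact (contDiff_apply ℝ ℝ k).comp (hSreg.comp h1)
      · intro s t hst
        exact hmon k 0 (by linarith)
      · intro u
        have := hline k 0 (u - b) 0
        simp only [b] at this ⊢
        linarith
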